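/- Let q ≥ 5 be a prime number and let G = C_3 ⊕ C_{3q} (concretely, G = (ℤ/3ℤ) × (ℤ/3qℤ)). Then every regular sequence S over G of length |S| = 3q + 3 is an additive basis of G, i.e., Σ(S) = G. -/

import Mathlib

open Multiset

/-- `subSums S` is Σ(S): the set of all sums of nonempty subsequences of `S`. -/
def subSums {G : Type*} [AddCommMonoid G] (S : Multiset G) : Set G :=
  {x | ∃ T : Multiset G, T ≤ S ∧ T ≠ 0 ∧ T.sum = x}

open scoped Classical in
/-- A sequence `S` over `G` is regular if for every proper subgroup `H` of `G`,
`S` contains at most `|H| - 1` terms from `H`. -/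
noncomputable def IsRegularSeq {G : Type*} [AddCommGroup G] (S : Multiset G) : Prop :=
  ∀ H : AddSubgroup G, H ≠ ⊤ →
    Multiset.card (S.filter (fun x => x ∈ H)) ≤ Nat.card H - 1

section TwistedDifferences

open Polynomial

theorem taylor_coeff_of_natDegree_le {K : Type*} [Field K] {p : K[X]} {n : ℕ} (hp : p.natDegree ≤ n)
    (r : K) : (taylor r p).coeff n = p.coeff n := by
  rcases hp.lt_or_eq with h | rfl
  · rw [coeff_eq_zero_of_natDegree_lt h, coeff_eq_zero_of_natDegree_lt (by simpa using h)]
  · simp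

theorem taylor_coeff_of_natDegree_le_succ {K : Type*} [Field K] {p : K[X]} {n : ℕ}
    (hp : p.natDegree ≤ n + 1) (r : K) :
    (taylor r p).coeff n = p.coeff n + (n + 1) * r * p.coeff (n + 1) := by
  have h : (hasseDeriv n p).natDegree < 2 :=
    (natDegree_hasseDeriv_le p n).trans_lt (by omega)
  rw [taylor_coeff, eval_eq_sum_range' h, Finset.sum_range_succ, Finset.sum_range_one,
    hasseDeriv_coeff, hasseDeriv_coeff, zero_add, add_comm 1 n, Nat.choose_self,
    Nat.choose_succ_self_right]
  push_cast
  ring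

theorem natDegree_sub_C_mul_taylor_le {K : Type*} [Field K] {p : K[X]} {n : ℕ}
    (hp : p.natDegree ≤ n) (b r : K) : (p - C b * taylor r p).natDegree ≤ n :=
  (natDegree_sub_le _ _).trans
    (max_le hp ((natDegree_C_mul_le _ _).trans (by simpa using hp)))

theorem natDegree_sub_taylor_le {K : Type*} [Field K] {p : K[X]} {n : ℕ}
    (hp : p.natDegree ≤ n + 1) (r : K) : (p - taylor r p).natDegree ≤ n := by
  rw [natDegree_le_iff_coeff_eq_zero]
  intro m hm
  rw [coeff_sub, taylor_coeff_of_natDegree_le (by omega : p.natDegree ≤ m), sub_self]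

/-- Apply the twisted differences `f ↦ f - c • f (· + g)`, for `(g, c)` in the list,
and evaluate at `0`. -/
def iterDiff {G K : Type*} [AddMonoid G] [Ring K] : List (G × K) → (G → K) → K
  | [], f => f 0
  | w :: l, f => iterDiff l fun x => f x - w.2 * f (x + w.1)

theorem iterDiff_eq_zero_of_subSums {G K : Type*} [AddCommMonoid G] [Ring K] (l : List (G × K))
    (f : G → K) (hf : ∀ T : Multiset G, T ≤ ((l.map Prod.fst : List G) : Multiset G) → f T.sum = 0) :
    iterDiff l f = 0 := by
  induction l generalizing f with
  | nil => simpa [iterDiff] using hf 0 (zero_le _)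
  | cons w l ih =>
    refine ih _ fun T hT => ?_
    have hle : w.1 ::ₘ T ≤ (((w :: l).map Prod.fst : List G) : Multiset G) := by
      simpa [← Multiset.cons_coe] using hT
    have h2 := hf _ hle
    rw [Multiset.sum_cons, add_comm] at h2
    simp only [hf T ((Multiset.le_cons_self _ _).trans hle), h2, mul_zero, sub_zero]

theorem iterDiff_sum {G K ι : Type*} [AddMonoid G] [Ring K] (l : List (G × K)) (s : Finset ι)
    (f : ι → G → K) : iterDiff l (fun x => ∑ i ∈ s, f i x) = ∑ i ∈ s, iterDiff l (f i) := by
  induction l generalizing f with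
  | nil => rfl
  | cons w l ih => simp only [iterDiff, ← ih, Finset.mul_sum, Finset.sum_sub_distrib]

theorem iterDiff_const_mul {G K : Type*} [AddMonoid G] [CommRing K] (l : List (G × K)) (k : K)
    (f : G → K) : iterDiff l (fun x => k * f x) = k * iterDiff l f := by
  induction l generalizing f with
  | nil => rfl
  | cons w l ih =>
    simp only [iterDiff, ← ih]
    congr 1
    ext x
    ring

theorem iterDiff_cons_char_mul_eval {G K : Type*} [AddCommGroup G] [Field K] (χ : AddChar G K)
    (θ : G →+ K) (w : G × K) (l : List (G × K)) (p : K[X]) :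
    iterDiff (w :: l) (fun x => χ x * p.eval (θ x)) =
      iterDiff l (fun x => χ x * (p - C (w.2 * χ w.1) * taylor (θ w.1) p).eval (θ x)) := by
  rw [iterDiff]
  congr 1
  ext x
  simp only [AddChar.map_add_eq_mul, _root_.map_add, eval_sub, eval_mul, eval_C, taylor_eval]
  ring

open scoped Classical in
theorem iterDiff_char_mul_eval_eq_zero {G K : Type*} [AddCommGroup G] [Field K] (χ : AddChar G K)
    (θ : G →+ K) (l : List (G × K)) (p : K[X])
    (hp : p = 0 ∨ p.natDegree < l.countP (fun w => w.2 * χ w.1 = 1)) :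
    iterDiff l (fun x => χ x * p.eval (θ x)) = 0 := by
  induction l generalizing p with
  | nil => rcases hp with rfl | h <;> simp_all [iterDiff]
  | cons w l ih =>
    rw [iterDiff_cons_char_mul_eval]
    refine ih _ ?_
    rcases hp with rfl | h
    · simp
    by_cases hw : w.2 * χ w.1 = 1
    · rw [List.countP_cons_of_pos (by simpa using hw)] at h
      rw [hw, C_1, one_mul]
      rcases Nat.eq_zero_or_pos p.natDegree with h0 | h0
      · left
        rw [eq_C_of_natDegree_eq_zero h0]
        simp
      · right
        have := natDegree_sub_taylor_le (p := p) (n := p.natDegree - 1) (by omega) (θ w.1)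
        omega
    · rw [List.countP_cons_of_neg (by simpa using hw)] at h
      right
      exact (natDegree_sub_C_mul_taylor_le le_rfl _ _).trans_lt h

open scoped Classical in
theorem iterDiff_char_mul_eval_ne_zero {G K : Type*} [AddCommGroup G] [Field K] (χ : AddChar G K)
    (θ : G →+ K) (l : List (G × K)) (p : K[X]) (k : ℕ)
    (hk : l.countP (fun w => w.2 * χ w.1 = 1) = k)
    (hp : p.natDegree ≤ k) (hc : p.coeff k ≠ 0)
    (hchar : ∀ n : ℕ, 0 < n → n ≤ k → (n : K) ≠ 0)
    (hθ : ∀ w ∈ l, w.2 * χ w.1 = 1 → θ w.1 ≠ 0) :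
    iterDiff l (fun x => χ x * p.eval (θ x)) ≠ 0 := by
  induction l generalizing p k with
  | nil =>
    obtain rfl : 0 = k := by simpa using hk
    rw [iterDiff, _root_.map_zero θ, AddChar.map_zero_eq_one, one_mul, ← coeff_zero_eq_eval_zero]
    exact hc
  | cons w l ih =>
    rw [iterDiff_cons_char_mul_eval]
    by_cases hw : w.2 * χ w.1 = 1
    · rw [List.countP_cons_of_pos (by simpa using hw)] at hk
      subst hk
      refine ih _ _ rfl ?_ ?_ (fun n h0 hn => hchar n h0 (by omega))
        (fun w' hw' => hθ w' (List.mem_cons_of_mem _ hw'))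
      · rw [hw, C_1, one_mul]
        exact natDegree_sub_taylor_le hp _
      · rw [hw, C_1, one_mul, coeff_sub, taylor_coeff_of_natDegree_le_succ hp, sub_add_cancel_left,
          neg_ne_zero]
        refine mul_ne_zero (mul_ne_zero ?_ (hθ w List.mem_cons_self hw)) hc
        exact_mod_cast hchar _ (Nat.succ_pos _) le_rfl
    · rw [List.countP_cons_of_neg (by simpa using hw)] at hk
      refine ih _ k hk (natDegree_sub_C_mul_taylor_le hp _ _) ?_ hchar
        (fun w' hw' => hθ w' (List.mem_cons_of_mem _ hw'))
      rw [coeff_sub, coeff_C_mul, taylor_coeff_of_natDegree_le hp, ← one_sub_mul]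
      exact mul_ne_zero (sub_ne_zero.2 (Ne.symm hw)) hc

/-- The standard bilinear form on `𝔽₃²`. -/
def dot (u v : ZMod 3 × ZMod 3) : ZMod 3 := u.1 * v.1 + u.2 * v.2

theorem sum_char_dot {K : Type*} [Field K] {ψ : AddChar (ZMod 3) K} (hψ : ψ.IsPrimitive)
    {v : ZMod 3 × ZMod 3} (hv : v ≠ 0) : ∑ u, ψ (dot u v) = 0 := by
  simp only [dot, AddChar.map_add_eq_mul, Fintype.sum_prod_type, ← Finset.mul_sum,
    ← Finset.sum_mul, AddChar.sum_mulShift _ hψ]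
  by_contra h
  apply hv
  ext
  · by_contra h1
    exact h (by simp [show v.1 ≠ 0 from h1])
  · by_contra h1
    exact h (by simp [show v.2 ≠ 0 from h1])

theorem exists_sum_eq_of_cover {G : Type*} [AddCommGroup G] {q : ℕ} [Fact q.Prime] (hq3 : q ≠ 3)
    (v : G →+ ZMod 3 × ZMod 3) (a : G →+ ZMod q) (hinj : ∀ x, v x = 0 → a x = 0 → x = 0)
    (W : List (G × (ZMod 3 × ZMod 3)))
    (hcov : ∀ u ≠ 0, q ≤ W.countP (fun w => dot (u - w.2) (v w.1) = 0))
    (hzero : W.countP (fun w => dot (0 - w.2) (v w.1) = 0) = q - 1)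
    (hne : ∀ w ∈ W, dot (0 - w.2) (v w.1) = 0 → a w.1 ≠ 0) (g : G) :
    ∃ T : Multiset G, T ≤ ((W.map Prod.fst : List G) : Multiset G) ∧ T.sum = g := by
  classical
  by_contra! hg
  have hqp : q.Prime := Fact.out
  have h30 : ((3 : ℕ) : ZMod q) ≠ 0 := by
    rw [Ne, ZMod.natCast_eq_zero_iff]
    intro h
    exact hq3 ((Nat.prime_dvd_prime_iff_eq hqp Nat.prime_three).1 h)
  have : NeZero ((3 : ℕ) : ZMod q) := ⟨h30⟩
  let K := CyclotomicField 3 (ZMod q)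
  let ι : ZMod q →+* K := algebraMap (ZMod q) K
  have hι : Function.Injective ι := ι.injective
  have : CharP K q := charP_of_injective_algebraMap hι q
  have hζ := IsCyclotomicExtension.zeta_spec 3 (ZMod q) K
  obtain ⟨ψ, hψ⟩ : ∃ ψ : AddChar (ZMod 3) K, ψ.IsPrimitive :=
    ⟨_, AddChar.zmodChar_primitive_of_primitive_root 3 hζ⟩
  let χ : ZMod 3 × ZMod 3 → AddChar G K := fun u =>
    { toFun := fun x => ψ (dot u (v x))
      map_zero_eq_one' := by simp [dot]
      map_add_eq_mul' := fun x y => by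
        rw [← AddChar.map_add_eq_mul]
        congr 1
        simp only [dot, _root_.map_add, Prod.fst_add, Prod.snd_add]
        ring }
  let θ : G →+ K := (ι : ZMod q →+ K).comp a
  let p : K[X] := 1 - (X - C (θ g)) ^ (q - 1)
  let l : List (G × K) := W.map fun w => (w.1, ψ (-dot w.2 (v w.1)))
  have hcount (u : ZMod 3 × ZMod 3) : l.countP (fun w => w.2 * χ u w.1 = 1) =
      W.countP (fun w => dot (u - w.2) (v w.1) = 0) := by
    simp only [l, List.countP_map]
    congr 1
    ext w
    simp only [Function.comp, χ, AddChar.coe_mk, ← AddChar.map_add_eq_mul,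
      hψ.zmod_char_eq_one_iff]
    congr! 2
    simp only [dot, Prod.fst_sub, Prod.snd_sub]
    ring
  have hq1 := hqp.two_le
  have hdeg : ((X - C (θ g)) ^ (q - 1)).natDegree = q - 1 := by simp
  have hpdeg : p.natDegree ≤ q - 1 :=
    (natDegree_sub_le _ _).trans (by simp [hdeg])
  have hpc : p.coeff (q - 1) ≠ 0 := by
    have : ((X - C (θ g)) ^ (q - 1)).coeff (q - 1) = 1 := by
      have := ((monic_X_sub_C (θ g)).pow (q - 1)).coeff_natDegree
      rwa [hdeg] at this
    simp only [p, coeff_sub, this, coeff_one]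
    rw [if_neg (by omega)]
    simp
  have hvan : iterDiff l (fun x => ∑ u, ψ (-dot u (v g)) * (χ u x * p.eval (θ x))) = 0 := by
    apply iterDiff_eq_zero_of_subSums
    intro T hT
    have hmap : l.map Prod.fst = W.map Prod.fst := by simp [l]
    rw [hmap] at hT
    have hTg := hg T hT
    simp only [← mul_assoc, ← Finset.sum_mul]
    by_cases hv : v T.sum = v g
    · have ha : a T.sum ≠ a g := fun ha =>
        hTg (sub_eq_zero.1 (hinj _ (by rw [_root_.map_sub, hv, sub_self]) (by rw [_root_.map_sub, ha, sub_self])))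
      have : p.eval (θ T.sum) = 0 := by
        simp only [p, eval_sub, eval_one, eval_pow, eval_X, eval_C, θ, AddMonoidHom.comp_apply,
          AddMonoidHom.coe_coe]
        rw [← _root_.map_sub, ← map_pow, ZMod.pow_card_sub_one_eq_one (sub_ne_zero.2 ha), map_one, sub_self]
      rw [this, mul_zero]
    · have := sum_char_dot hψ (sub_ne_zero.2 hv)
      refine mul_eq_zero_of_left (this ▸ ?_) _
      refine Finset.sum_congr rfl fun u _ => ?_
      simp only [χ, AddChar.coe_mk, ← AddChar.map_add_eq_mul]
      congr 1
      simp only [dot, Prod.fst_sub, Prod.snd_sub]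
      ring
  rw [iterDiff_sum, Finset.sum_eq_single 0] at hvan
  · rw [iterDiff_const_mul] at hvan
    refine mul_ne_zero ?_ ?_ hvan
    · simp [dot]
    · refine iterDiff_char_mul_eval_ne_zero (χ 0) θ l p (q - 1) ?_ hpdeg hpc ?_ ?_
      · rw [hcount, hzero]
      · intro n h0 hn h
        rw [CharP.cast_eq_zero_iff K q] at h
        have := Nat.le_of_dvd h0 h
        omega
      · intro w' hw' h1 h2
        obtain ⟨w, hw, rfl⟩ := List.mem_map.1 hw'
        refine hne w hw ?_ (hι (by simpa [θ] using h2))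
        simp only [χ, AddChar.coe_mk, ← AddChar.map_add_eq_mul, hψ.zmod_char_eq_one_iff] at h1
        rw [← h1]
        simp only [dot, Prod.fst_sub, Prod.snd_sub]
        ring
  · intro u _ hu
    rw [iterDiff_const_mul, iterDiff_char_mul_eval_eq_zero, mul_zero]
    right
    rw [hcount]
    have := hcov u hu
    omega
  · simp

end TwistedDifferences

/-- Representatives of the four lines through the origin of `𝔽₃²`. -/
def dir : Fin 4 → ZMod 3 × ZMod 3 := ![(1, 0), (0, 1), (1, 1), (1, 2)]

/-- Vectors dual to those of `dir`. -/
def dualDir : Fin 4 → ZMod 3 × ZMod 3 := ![(1, 0), (0, 1), (1, 0), (1, 0)]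

theorem dot_sub_smul_dualDir (d : Fin 4) (u : ZMod 3 × ZMod 3) (z : ZMod 3) :
    dot (u - z • dualDir d) (dir d) = dot u (dir d) - z := by
  have h : dot (dualDir d) (dir d) = 1 := by revert d; decide
  calc _ = dot u (dir d) - z * dot (dualDir d) (dir d) := by simp only [dot]; simp; ring
    _ = _ := by rw [h, mul_one]

theorem dot_neg_right (u w : ZMod 3 × ZMod 3) : dot u (-w) = -dot u w := by
  simp only [dot, Prod.fst_neg, Prod.snd_neg]
  ring

theorem dot_neg_left (u w : ZMod 3 × ZMod 3) : dot (-u) w = -dot u w := by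
  simp only [dot, Prod.fst_neg, Prod.snd_neg]
  ring

theorem dot_ne_zero_of_ne {i j : Fin 4} (hij : i ≠ j) {u : ZMod 3 × ZMod 3} (hu : u ≠ 0)
    (hi : dot u (dir i) = 0) : dot u (dir j) ≠ 0 := by
  revert i j u
  decide

/-- `E` prescribes extra lines `{u | dot u (dir d) = z}`, with multiplicity `E d z`, avoiding `0`
and covering every other point of `𝔽₃²`, such that after using them there remain enough elements
to cover everything uniformly `t - 1` times. -/
def IsDesign (n : Fin 4 → ℕ) (t : ℕ) (E : Fin 4 → ZMod 3 → ℕ) : Prop :=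
  (∀ d, E d 0 = 0) ∧ (∀ u ≠ 0, ∃ d, E d (dot u (dir d)) ≠ 0) ∧ (∀ d, E d 1 + E d 2 ≤ n d) ∧
    t ≤ ∑ d, (n d - (E d 1 + E d 2)) / 3 + 1 ∧ ∑ d, (E d 1 + E d 2) ≤ 4

theorem exists_isDesign_of_pair {n : Fin 4 → ℕ} {t : ℕ} {i j : Fin 4} (hij : i ≠ j)
    (hi : 2 ≤ n i) (hj : 2 ≤ n j)
    (ht : t + 1 ≤ ∑ d, n d / 3 + (n i % 3) / 2 + (n j % 3) / 2) : ∃ E, IsDesign n t E := by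
  refine ⟨fun d z => if (d = i ∨ d = j) ∧ z ≠ 0 then 1 else 0, by simp, ?_, ?_, ?_, ?_⟩
  · clear hi hj ht
    revert i j
    decide
  · intro d
    by_cases h1 : d = i
    · subst h1; simpa [show (2 : ZMod 3) ≠ 0 by decide] using hi
    by_cases h2 : d = j
    · subst h2; simpa [show (2 : ZMod 3) ≠ 0 by decide] using hj
    simp [h1, h2]
  · rw [Fin.sum_univ_four] at *
    fin_cases i <;> fin_cases j <;> simp [show (2 : ZMod 3) ≠ 0 by decide] at * <;> omega
  · clear hi hj ht
    revert i j
    decide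

theorem exists_isDesign_of_triple {n : Fin 4 → ℕ} {t : ℕ} {i j k : Fin 4} (hij : i ≠ j)
    (hik : i ≠ k) (hjk : j ≠ k) (hi : 3 ≤ n i) (hj : n j % 3 = 1) (hk : n k % 3 = 1)
    (ht : t ≤ ∑ d, n d / 3) : ∃ E, IsDesign n t E := by
  obtain ⟨u₀, hu₀, hi₀, hline⟩ : ∃ u₀ ≠ 0, dot u₀ (dir i) = 0 ∧
      ∀ u ≠ 0, dot u (dir i) = 0 → u = u₀ ∨ u = -u₀ := by
    clear hi hj hk ht hij hik
    revert i
    decide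
  have hx := dot_ne_zero_of_ne hij hu₀ hi₀
  have hy := dot_ne_zero_of_ne hik (neg_ne_zero.2 hu₀) (by rw [dot_neg_left, hi₀, neg_zero])
  have hone (x : ZMod 3) (hx : x ≠ 0) : (if 1 = x then 1 else 0) + (if 2 = x then 1 else 0) = 1 := by
    revert x
    decide
  let E : Fin 4 → ZMod 3 → ℕ := fun d z =>
    if d = i then (if z = 0 then 0 else 1) else if d = j then (if z = dot u₀ (dir j) then 1 else 0)
      else if d = k then (if z = dot (-u₀) (dir k) then 1 else 0) else 0
  have hE (d : Fin 4) : E d 1 + E d 2 =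
      if d = i then 2 else if d = j then 1 else if d = k then 1 else 0 := by
    by_cases h1 : d = i
    · simp only [E, if_pos h1]
      decide
    by_cases h2 : d = j
    · simp only [E, if_neg h1, if_pos h2]
      exact hone _ hx
    by_cases h3 : d = k
    · simp only [E, if_neg h1, if_neg h2, if_pos h3]
      exact hone _ hy
    simp only [E, if_neg h1, if_neg h2, if_neg h3]
  refine ⟨E, fun d => ?_, fun u hu => ?_, fun d => ?_, ?_, ?_⟩
  · simp only [E, if_neg hx.symm, if_neg hy.symm, if_true, ite_self]
  · by_cases h : dot u (dir i) = 0
    · rcases hline u hu h with rfl | rfl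
      · exact ⟨j, by simp [E, hij.symm]⟩
      · exact ⟨k, by simp [E, hik.symm, hjk.symm]⟩
    · exact ⟨i, by simp [E, h]⟩
  · rw [hE]
    split_ifs with h1 h2 h3
    · subst h1; omega
    · subst h2; omega
    · subst h3; omega
    · omega
  · simp only [hE]
    rw [Fin.sum_univ_four] at *
    clear hE E hx hy hone hline hi₀ hu₀
    fin_cases i <;> fin_cases j <;> fin_cases k <;> simp at * <;> omega
  · simp only [hE]
    clear hE E hx hy hone hline hi₀ hu₀ hi hj hk ht
    revert i j k
    decide

theorem exists_isDesign {n : Fin 4 → ℕ} {t : ℕ} (ht : 1 ≤ t) (hsum : 3 * t + 3 ≤ ∑ d, n d)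
    (hmax : ∀ i, n i + 4 ≤ ∑ d, n d) : ∃ E, IsDesign n t E := by
  have hother (i : Fin 4) : ∃ j, i ≠ j ∧ 2 ≤ n j := by
    by_contra! h
    have h0 := hmax i
    rw [Fin.sum_univ_four] at h0
    have h1 := h 0; have h2 := h 1; have h3 := h 2; have h4 := h 3
    fin_cases i <;> simp at * <;> omega
  have hsum' := hsum
  rw [Fin.sum_univ_four] at hsum'
  by_cases h2 : ∃ i j, i ≠ j ∧ n i % 3 = 2 ∧ n j % 3 = 2
  · obtain ⟨i, j, hij, hi, hj⟩ := h2
    refine exists_isDesign_of_pair hij (by omega) (by omega) ?_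
    rw [hi, hj, Fin.sum_univ_four]
    omega
  push Not at h2
  by_cases h1 : ∃ i, n i % 3 = 2
  · obtain ⟨i, hi⟩ := h1
    obtain ⟨j, hij, hj⟩ := hother i
    refine exists_isDesign_of_pair hij (by omega) hj ?_
    rw [hi, Fin.sum_univ_four]
    have e0 := h2 i 0; have e1 := h2 i 1; have e2 := h2 i 2; have e3 := h2 i 3
    clear h2 hother hmax hsum hij
    fin_cases i <;> simp at * <;> omega
  push Not at h1
  have e0 := h1 0; have e1 := h1 1; have e2 := h1 2; have e3 := h1 3
  by_cases h : t + 1 ≤ ∑ d, n d / 3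
  · obtain ⟨i, -, hi⟩ := hother 0
    obtain ⟨j, hij, hj⟩ := hother i
    exact exists_isDesign_of_pair hij hi hj (by omega)
  · rw [Fin.sum_univ_four] at h
    obtain ⟨i, hi⟩ : ∃ i, 3 ≤ n i := by
      by_contra! h'
      have := h' 0; have := h' 1; have := h' 2; have := h' 3
      omega
    obtain ⟨j, k, hij, hik, hjk, hj, hk⟩ : ∃ j k, i ≠ j ∧ i ≠ k ∧ j ≠ k ∧ n j % 3 = 1 ∧
        n k % 3 = 1 := by
      by_contra! h'
      have f01 := h' 0 1; have f02 := h' 0 2; have f03 := h' 0 3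
      have f12 := h' 1 2; have f13 := h' 1 3; have f23 := h' 2 3
      clear h' h1 h2 hother hmax hsum
      fin_cases i <;> simp at * <;> omega
    refine exists_isDesign_of_triple hij hik hjk hi hj hk ?_
    rw [Fin.sum_univ_four]
    omega

theorem exists_le_sum_eq (A : Fin 4 → ℕ) {s : ℕ} (hs : s ≤ ∑ d, A d) :
    ∃ α : Fin 4 → ℕ, (∀ d, α d ≤ A d) ∧ ∑ d, α d = s := by
  rw [Fin.sum_univ_four] at hs
  obtain ⟨w, x, y, z, hw, hx, hy, hz, h⟩ : ∃ w x y z, w ≤ A 0 ∧ x ≤ A 1 ∧ y ≤ A 2 ∧ z ≤ A 3 ∧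
      w + x + y + z = s :=
    ⟨min (A 0) s, min (A 1) (s - A 0), min (A 2) (s - A 0 - A 1), s - A 0 - A 1 - A 2,
      by omega, by omega, by omega, by omega, by omega⟩
  refine ⟨![w, x, y, z], fun d => ?_, by simpa [Fin.sum_univ_four] using h⟩
  fin_cases d <;> assumption

theorem exists_le_card_eq {G : Type*} {M : Multiset G} {n : ℕ} (h : n ≤ card M) :
    ∃ T ≤ M, card T = n := by
  obtain ⟨T, hT⟩ := card_pos_iff_exists_mem.1
    ((Nat.choose_pos h).trans_eq (card_powersetCard n M).symm)
  exact ⟨T, mem_powersetCard.1 hT⟩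

theorem exists_split {G : Type*} {M : Multiset G} {p : G → Prop} [DecidablePred p]
    (w : ZMod 3 → ℕ) (h0 : w 0 ≤ card (M.filter p)) (hw : w 0 + (w 1 + w 2) ≤ card M) :
    ∃ T : ZMod 3 → Multiset G, ∑ z, T z ≤ M ∧ (∀ z, card (T z) = w z) ∧ ∀ x ∈ T 0, p x := by
  classical
  obtain ⟨T₀, hT₀, hc₀⟩ := exists_le_card_eq h0
  have hT₀M := hT₀.trans (filter_le p M)
  obtain ⟨T₁, hT₁, hc₁⟩ := exists_le_card_eq (M := M - T₀) (n := w 1)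
    (by rw [card_sub hT₀M]; omega)
  have hT₁M : T₀ + T₁ ≤ M := by
    rw [add_comm]
    exact (add_le_add_left hT₁ T₀).trans_eq (Multiset.sub_add_cancel hT₀M)
  obtain ⟨T₂, hT₂, hc₂⟩ := exists_le_card_eq (M := M - (T₀ + T₁)) (n := w 2)
    (by rw [card_sub hT₁M, card_add]; omega)
  have hT₂M : T₀ + T₁ + T₂ ≤ M := by
    rw [add_comm]
    exact (add_le_add_left hT₂ _).trans_eq (Multiset.sub_add_cancel hT₁M)
  refine ⟨![T₀, T₁, T₂], ?_, fun z => ?_, fun x hx => of_mem_filter (mem_of_le hT₀ hx)⟩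
  · exact (Fin.sum_univ_three (![T₀, T₁, T₂] : Fin 3 → Multiset G)).trans_le hT₂M
  · fin_cases z <;> assumption

theorem zero_ne_dir (d : Fin 4) : ¬(0 = dir d ∨ 0 = -dir d) := by
  revert d
  decide

theorem filter_add_sum_filter_dir {G : Type*} (v : G → ZMod 3 × ZMod 3) (S : Multiset G) :
    S.filter (fun x => v x = 0) + ∑ d, S.filter (fun x => v x = dir d ∨ v x = -dir d) = S := by
  classical
  ext x
  rw [Fin.sum_univ_four]
  simp only [count_add, count_filter]
  have h : ∀ y : ZMod 3 × ZMod 3, ∀ c : ℕ, (if y = 0 then c else 0) +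
      ((if y = dir 0 ∨ y = -dir 0 then c else 0) + (if y = dir 1 ∨ y = -dir 1 then c else 0) +
      (if y = dir 2 ∨ y = -dir 2 then c else 0) +
      (if y = dir 3 ∨ y = -dir 3 then c else 0)) = c := by
    intro y c
    have h' : ∀ y : ZMod 3 × ZMod 3, (if y = 0 then 1 else 0) +
      ((if y = dir 0 ∨ y = -dir 0 then 1 else 0) + (if y = dir 1 ∨ y = -dir 1 then 1 else 0) +
      (if y = dir 2 ∨ y = -dir 2 then 1 else 0) +
      (if y = dir 3 ∨ y = -dir 3 then 1 else 0)) = 1 := by decide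
    have := congrArg (· * c) (h' y)
    simpa only [add_mul, ite_mul, one_mul, zero_mul] using this
  exact h _ _

theorem countP_map_label {G L : Type*} (M : Multiset G) (ℓ : L) (p : G × L → Prop)
    [DecidablePred p] (P : Prop) [Decidable P] (h : ∀ x ∈ M, p (x, ℓ) ↔ P) :
    countP p (M.map fun x => (x, ℓ)) = if P then card M else 0 := by
  rw [countP_map, filter_congr h]
  split_ifs with hP <;> simp [hP]

theorem subSums_eq_univ_of_card_bounds {G : Type*} [AddCommGroup G] {q : ℕ} [Fact q.Prime]
    (hq3 : q ≠ 3) (v : G →+ ZMod 3 × ZMod 3) (a : G →+ ZMod q)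
    (hinj : ∀ x, v x = 0 → a x = 0 → x = 0) (S : Multiset G) (hlen : card S = 3 * q + 3)
    (hzero : ∀ x ∈ S, x ≠ 0)
    (hker : card (S.filter fun x => v x = 0) ≤ q - 1)
    (hdir : ∀ d, card (S.filter fun x => v x = 0) +
      card (S.filter fun x => v x = dir d ∨ v x = -dir d) ≤ 3 * q - 1)
    (htors : ∀ d, card ((S.filter fun x => v x = dir d ∨ v x = -dir d).filter
      fun x => a x = 0) ≤ 2) :
    subSums S = Set.univ := by
  classical
  have hq2 := (Fact.out : q.Prime).two_le
  have hpart := filter_add_sum_filter_dir v S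
  set S₀ := S.filter fun x => v x = 0
  let M : Fin 4 → Multiset G := fun d => S.filter fun x => v x = dir d ∨ v x = -dir d
  replace hdir (d : Fin 4) : card S₀ + card (M d) ≤ 3 * q - 1 := hdir d
  replace htors (d : Fin 4) : card ((M d).filter fun x => a x = 0) ≤ 2 := htors d
  replace hpart : S₀ + ∑ d, M d = S := hpart
  have hcard : card S₀ + ∑ d, card (M d) = 3 * q + 3 := by
    rw [← hlen, ← hpart, card_add, card_sum]
  obtain ⟨E, hE0, hEcov, hEle, hEt, hE4⟩ := exists_isDesign (n := fun d => card (M d))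
    (t := q - card S₀) (by omega) (by omega) (fun d => by have := hdir d; omega)
  beta_reduce at hEle hEt
  obtain ⟨α, hα, hαsum⟩ := exists_le_sum_eq
    (fun d => (card (M d) - (E d 1 + E d 2)) / 3) (s := q - card S₀ - 1) (by omega)
  have hsplit (d : Fin 4) := exists_split (M := M d) (p := fun x => a x ≠ 0)
    (fun z => α d + E d z)
    (by
      have h1 := htors d
      have h2 := congrArg card (filter_add_not (fun x => a x = 0) (M d))
      have h3 := hα d
      have h4 := hEle d
      rw [card_add] at h2
      simp only [hE0, ne_eq]
      omega)
    (by
      have h3 := hα d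
      have h4 := hEle d
      simp only [hE0]
      omega)
  choose T hTle hTcard hTne using hsplit
  let W : Multiset (G × (ZMod 3 × ZMod 3)) := S₀.map (fun x => (x, 0)) +
    ∑ d, ∑ z, (T d z).map (fun x => (x, z • dualDir d))
  have hTM (d : Fin 4) (z : ZMod 3) {x : G} (hx : x ∈ T d z) : v x = dir d ∨ v x = -dir d := by
    have : x ∈ M d := mem_of_le ((Finset.single_le_sum (f := T d) (fun _ _ => Multiset.zero_le _)
      (Finset.mem_univ z)).trans (hTle d)) hx
    exact (mem_filter.1 this).2
  have hdot (d : Fin 4) (z : ZMod 3) (u) {x : G} (hx : x ∈ T d z) :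
      dot (u - z • dualDir d) (v x) = 0 ↔ dot u (dir d) = z := by
    have h0 : dot (u - z • dualDir d) (dir d) = 0 ↔ dot u (dir d) = z := by
      rw [dot_sub_smul_dualDir, sub_eq_zero]
    rcases hTM d z hx with h | h
    · rw [h, h0]
    · rw [h, dot_neg_right, neg_eq_zero, h0]
  have hcount (u : ZMod 3 × ZMod 3) : W.countP (fun w => dot (u - w.2) (v w.1) = 0) =
      q - 1 + ∑ d, E d (dot u (dir d)) := by
    rw [← coe_countPAddMonoidHom, _root_.map_add, map_sum]
    simp only [map_sum, coe_countPAddMonoidHom]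
    rw [countP_map_label S₀ _ _ True (fun x hx => by
      simp [(mem_filter.1 hx).2, dot]), if_pos trivial]
    have h (d : Fin 4) (z : ZMod 3) := countP_map_label (T d z) (z • dualDir d)
      (fun w => dot (u - w.2) (v w.1) = 0) (dot u (dir d) = z) (fun x hx => hdot d z u hx)
    simp only [h, Finset.sum_ite_eq, Finset.mem_univ, if_true, hTcard, Finset.sum_add_distrib,
      hαsum]
    omega
  have hWfst : W.map Prod.fst = S₀ + ∑ d, ∑ z, T d z := by
    rw [← coe_mapAddMonoidHom, _root_.map_add, map_sum]
    simp only [map_sum, coe_mapAddMonoidHom, Multiset.map_map, Function.comp_def, map_id']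
  have hWle : W.map Prod.fst ≤ S := by
    rw [hWfst, ← hpart]
    exact add_le_add_right (Finset.sum_le_sum fun d _ => hTle d) _
  have hWlt : W.map Prod.fst < S := by
    refine lt_of_le_of_ne hWle fun h => ?_
    have h1 := congrArg card h
    rw [hWfst, card_add, card_sum, hlen] at h1
    have h2 (d : Fin 4) : card (∑ z, T d z) = 3 * α d + (E d 1 + E d 2) := by
      rw [card_sum, Finset.sum_congr rfl fun z _ => hTcard d z]
      refine (Fin.sum_univ_three fun z : Fin 3 => α d + E d z).trans ?_
      have := hE0 d
      change α d + E d 0 + (α d + E d 1) + (α d + E d 2) = _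
      omega
    simp only [h2, Finset.sum_add_distrib, ← Finset.mul_sum, hαsum] at h1 hE4
    omega
  have hrep (g : G) : ∃ T ≤ W.map Prod.fst, T.sum = g := by
    have hlist (u : ZMod 3 × ZMod 3) :
        W.toList.countP (fun w => dot (u - w.2) (v w.1) = 0) =
          q - 1 + ∑ d, E d (dot u (dir d)) := by
      rw [← hcount, ← coe_countP, coe_toList]
    have := exists_sum_eq_of_cover hq3 v a hinj W.toList (fun u hu => ?_) ?_ (fun w hw hw0 => ?_) g
    · rwa [← Multiset.map_coe, coe_toList] at this
    · rw [hlist]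
      obtain ⟨d, hd⟩ := hEcov u hu
      have := Finset.single_le_sum (f := fun d => E d (dot u (dir d)))
        (fun _ _ => Nat.zero_le _) (Finset.mem_univ d)
      omega
    · rw [hlist]
      simp [dot, hE0]
    · rw [mem_toList] at hw
      rcases mem_add.1 hw with hw | hw
      · obtain ⟨x, hx, rfl⟩ := mem_map.1 hw
        obtain ⟨hxS, hvx⟩ := mem_filter.1 hx
        exact fun hax => hzero x hxS (hinj x hvx hax)
      · obtain ⟨d, -, hw⟩ := mem_sum.1 hw
        obtain ⟨z, -, hw⟩ := mem_sum.1 hw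
        obtain ⟨x, hx, rfl⟩ := mem_map.1 hw
        obtain rfl : 0 = z := by simpa [dot] using (hdot d z 0 hx).1 hw0
        exact hTne d x hx
  obtain ⟨s, hs⟩ := lt_iff_cons_le.1 hWlt
  refine Set.eq_univ_of_forall fun g => ?_
  obtain ⟨T, hT, hTsum⟩ := hrep (g - s)
  exact ⟨s ::ₘ T, (cons_le_cons s hT).trans hs, cons_ne_zero, by simp [hTsum]⟩

theorem card_comap_inf_comap_le {G V A : Type*} [AddCommGroup G] [AddCommGroup V] [AddCommGroup A]
    [Finite V] [Finite A] (v : G →+ V) (a : G →+ A) (hinj : ∀ x, v x = 0 → a x = 0 → x = 0)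
    (X : AddSubgroup V) (Y : AddSubgroup A) :
    Nat.card (X.comap v ⊓ Y.comap a : AddSubgroup G) ≤ Nat.card X * Nat.card Y := by
  rw [← Nat.card_prod]
  refine Nat.card_le_card_of_injective
    (fun x => ((⟨v x, x.2.1⟩ : X), (⟨a x, x.2.2⟩ : Y))) fun x y hxy => ?_
  have hv : v x = v y := congrArg (fun w => (w.1 : V)) hxy
  have ha : a x = a y := congrArg (fun w => (w.2 : A)) hxy
  refine Subtype.ext (sub_eq_zero.1 (hinj _ ?_ ?_))
  · rw [_root_.map_sub, hv, sub_self]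
  · rw [_root_.map_sub, ha, sub_self]

open scoped Classical in
theorem IsRegularSeq.card_filter_le {G V A : Type*} [AddCommGroup G] [AddCommGroup V]
    [AddCommGroup A] [Finite V] [Finite A] {S : Multiset G} (hS : IsRegularSeq S) (v : G →+ V)
    (a : G →+ A) (hinj : ∀ x, v x = 0 → a x = 0 → x = 0) (X : AddSubgroup V) (Y : AddSubgroup A)
    (hlt : Nat.card X * Nat.card Y < Nat.card G) :
    card (S.filter fun x => v x ∈ X ∧ a x ∈ Y) ≤ Nat.card X * Nat.card Y - 1 := by
  have hle := card_comap_inf_comap_le v a hinj X Y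
  have hne : X.comap v ⊓ Y.comap a ≠ ⊤ := fun h => by
    rw [h, AddSubgroup.card_top] at hle
    omega
  refine (le_of_eq ?_).trans ((hS _ hne).trans (Nat.sub_le_sub_right hle 1))
  exact congrArg card (filter_congr fun x _ => Iff.rfl)

theorem natCard_zmultiples_le_three (w : ZMod 3 × ZMod 3) :
    Nat.card (AddSubgroup.zmultiples w) ≤ 3 := by
  rw [Nat.card_zmultiples]
  exact addOrderOf_le_of_nsmul_eq_zero (by norm_num) (by revert w; decide)

/-- For a prime q ≥ 5, every regular sequence over `(ℤ/3ℤ) × (ℤ/3qℤ)` of length `3q + 3`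
is an additive basis. -/
theorem regular_length_is_basis (q : ℕ) (hq : q.Prime) (hq5 : 5 ≤ q)
    (S : Multiset (ZMod 3 × ZMod (3 * q)))
    (hreg : IsRegularSeq S) (hlen : Multiset.card S = 3 * q + 3) :
    subSums S = Set.univ := by
  classical
  have : Fact q.Prime := ⟨hq⟩
  have : NeZero q := ⟨hq.ne_zero⟩
  let v : ZMod 3 × ZMod (3 * q) →+ ZMod 3 × ZMod 3 :=
    (AddMonoidHom.id _).prodMap (ZMod.castHom (dvd_mul_right 3 q) (ZMod 3)).toAddMonoidHom
  let a : ZMod 3 × ZMod (3 * q) →+ ZMod q :=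
    (ZMod.castHom (dvd_mul_left q 3) (ZMod q)).toAddMonoidHom.comp (AddMonoidHom.snd _ _)
  have hcop : Nat.Coprime 3 q :=
    (Nat.coprime_primes Nat.prime_three hq).2 (by omega)
  have hinj : ∀ x, v x = 0 → a x = 0 → x = 0 := by
    rintro ⟨x, y⟩ hv ha
    obtain ⟨n, rfl⟩ := ZMod.natCast_zmod_surjective y
    have hv' : x = 0 ∧ (n : ZMod 3) = 0 := by simpa [v] using hv
    have ha' : (n : ZMod q) = 0 := by simpa [a] using ha
    rw [ZMod.natCast_eq_zero_iff] at hv' ha'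
    rw [hv'.1, (ZMod.natCast_eq_zero_iff n (3 * q)).2 (hcop.mul_dvd_of_dvd_of_dvd hv'.2 ha')]
    rfl
  have hG : Nat.card (ZMod 3 × ZMod (3 * q)) = 9 * q := by
    rw [Nat.card_prod, Nat.card_zmod, Nat.card_zmod]
    ring
  have hbound := hreg.card_filter_le v a hinj
  rw [hG] at hbound
  have hline (d : Fin 4) := natCard_zmultiples_le_three (dir d)
  have hmem (d : Fin 4) (x) (hx : v x = dir d ∨ v x = -dir d) :
      v x ∈ AddSubgroup.zmultiples (dir d) := by
    rcases hx with h | h <;> rw [h]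
    · exact AddSubgroup.mem_zmultiples _
    · exact neg_mem (AddSubgroup.mem_zmultiples _)
  refine subSums_eq_univ_of_card_bounds (by omega) v a hinj S hlen ?_ ?_ ?_ ?_
  · rintro x hx rfl
    have h := hbound ⊥ ⊥ (by simp; omega)
    simp only [AddSubgroup.card_bot, mul_one, Nat.sub_self, Nat.le_zero, card_eq_zero,
      filter_eq_nil] at h
    exact h 0 hx (by simp)
  · have h := hbound ⊥ ⊤ (by simp; omega)
    simpa using h
  · intro d
    have h := hbound (AddSubgroup.zmultiples (dir d)) ⊤ (by
      rw [AddSubgroup.card_top, Nat.card_zmod]; nlinarith [hline d])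
    rw [AddSubgroup.card_top, Nat.card_zmod] at h
    have h3 : Nat.card (AddSubgroup.zmultiples (dir d)) * q ≤ 3 * q :=
      Nat.mul_le_mul_right q (hline d)
    have hdisj : S.filter (fun x => v x = 0) + S.filter (fun x => v x = dir d ∨ v x = -dir d) =
        S.filter (fun x => v x = 0 ∨ v x = dir d ∨ v x = -dir d) := by
      rw [filter_add_filter, add_eq_left, filter_eq_nil]
      rintro x - ⟨h1, h2⟩
      rw [h1] at h2
      exact zero_ne_dir d h2
    rw [← card_add, hdisj]
    refine (card_le_card (monotone_filter_right S ?_)).trans (h.trans (Nat.sub_le_sub_right h3 1))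
    rintro x (hx | hx)
    · exact ⟨hx ▸ zero_mem _, AddSubgroup.mem_top _⟩
    · exact ⟨hmem d x hx, AddSubgroup.mem_top _⟩
  · intro d
    have h := hbound (AddSubgroup.zmultiples (dir d)) ⊥ (by
      rw [AddSubgroup.card_bot]; have := hline d; omega)
    rw [AddSubgroup.card_bot, mul_one] at h
    rw [filter_filter]
    refine (card_le_card (monotone_filter_right S ?_)).trans
      (h.trans (Nat.sub_le_sub_right (hline d) 1))
    rintro x ⟨hx0, hx⟩
    exact ⟨hmem d x hx, hx0⟩
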